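/- Let A be an n×n sign pattern of cycle form such that every directed 2-cycle of D(A) is negative, D(A_+) contains a directed cycle of length n, sign(a_{ij} a_{ji}) = − for some i ≠ j, and A requires algebraic positivity. If D(A_-) contains a directed cycle of length n, then n is odd and a_{ii} = 0 for all i. -/

import Mathlib

open Matrix

/-- A real square matrix is algebraically positive if some real polynomial
evaluated at it has all entries positive. -/
def AlgPositive {n : ℕ} (M : Matrix (Fin n) (Fin n) ℝ) : Prop :=
  ∃ f : Polynomial ℝ, ∀ i j, 0 < Polynomial.aeval M f i j

/-- `B` belongs to the qualitative class of the sign pattern `A`. -/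
def InQClass {n : ℕ} (A : Matrix (Fin n) (Fin n) SignType)
    (B : Matrix (Fin n) (Fin n) ℝ) : Prop :=
  ∀ i j, SignType.sign (B i j) = A i j

/-- The sign pattern `A` requires algebraic positivity. -/
def RequiresAP {n : ℕ} (A : Matrix (Fin n) (Fin n) SignType) : Prop :=
  ∀ B : Matrix (Fin n) (Fin n) ℝ, InQClass A B → AlgPositive B

/-- An `n × n` sign pattern (indices read modulo `n`) is of cycle form if off-diagonal
entries away from the cycle `(0, 1, …, n-1, 0)` vanish and every edge of the cycle
carries at least one nonzero arc. -/
def CycleForm {n : ℕ} [NeZero n] (A : Matrix (Fin n) (Fin n) SignType) : Prop :=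
  (∀ i j : Fin n, i ≠ j → j ≠ i + 1 → i ≠ j + 1 → A i j = 0) ∧
  (∀ i : Fin n, A i (i + 1) ≠ 0 ∨ A (i + 1) i ≠ 0)

/-- For a cycle-form pattern, `D(A_+)` contains a directed cycle of length `n`. -/
def PlusNCycle {n : ℕ} [NeZero n] (A : Matrix (Fin n) (Fin n) SignType) : Prop :=
  (∀ i : Fin n, A i (i + 1) = 1) ∨ (∀ i : Fin n, A (i + 1) i = 1)

/-- For a cycle-form pattern, `D(A_-)` contains a directed cycle of length `n`. -/
def MinusNCycle {n : ℕ} [NeZero n] (A : Matrix (Fin n) (Fin n) SignType) : Prop :=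
  (∀ i : Fin n, A i (i + 1) = -1) ∨ (∀ i : Fin n, A (i + 1) i = -1)

section PositiveMatrix

variable {ι : Type*} [Fintype ι]

theorem mulVec_pos_of_pos {P : Matrix ι ι ℝ} (hP : ∀ i j, 0 < P i j) {z : ι → ℝ}
    (hz : ∀ i, 0 ≤ z i) {k : ι} (hk : z k ≠ 0) (i : ι) : 0 < (P *ᵥ z) i :=
  Finset.sum_pos' (fun j _ => mul_nonneg (hP i j).le (hz j))
    ⟨k, Finset.mem_univ k, mul_pos (hP i k) ((hz k).lt_of_ne' hk)⟩

theorem exists_mul_le_of_pos [Nonempty ι] {y z : ι → ℝ} (hy : ∀ i, 0 < y i) :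
    ∃ t, (∀ i, t * y i ≤ z i) ∧ ∃ i, t * y i = z i := by
  obtain ⟨i, hi⟩ := Finite.exists_min (fun i => z i / y i)
  refine ⟨z i / y i, fun j => ?_, i, div_mul_cancel₀ _ (hy i).ne'⟩
  exact (le_div_iff₀ (hy j)).1 (hi j)

/-- The Collatz–Wielandt set of pairs `(r, x)` with `x` in the simplex and `r x ≤ P x` has
a pair of maximal `r`. -/
theorem exists_max_mul_le_mulVec [Nonempty ι] {P : Matrix ι ι ℝ} (hP : ∀ i j, 0 < P i j) :
    ∃ r : ℝ, ∃ x ∈ stdSimplex ℝ ι, (∀ i, r * x i ≤ (P *ᵥ x) i) ∧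
      ∀ s : ℝ, ∀ y ∈ stdSimplex ℝ ι, (∀ i, s * y i ≤ (P *ᵥ y) i) → s ≤ r := by
  classical
  set R : ℝ := ∑ i, ∑ j, P i j
  have hR : 0 ≤ R := Finset.sum_nonneg fun i _ => Finset.sum_nonneg fun j _ => (hP i j).le
  have bound : ∀ s : ℝ, ∀ y ∈ stdSimplex ℝ ι, (∀ i, s * y i ≤ (P *ᵥ y) i) → s ≤ R := by
    intro s y hy h
    have h1 : ∑ i, s * y i ≤ ∑ i, (P *ᵥ y) i := Finset.sum_le_sum fun i _ => h i
    rw [← Finset.mul_sum, hy.2, mul_one] at h1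
    refine h1.trans (Finset.sum_le_sum fun i _ => Finset.sum_le_sum fun j _ => ?_)
    exact mul_le_of_le_one_right (hP i j).le ((mem_Icc_of_mem_stdSimplex hy j).2)
  let K : Set (ℝ × (ι → ℝ)) :=
    (Set.Icc 0 R ×ˢ stdSimplex ℝ ι) ∩ {p | ∀ i, p.1 * p.2 i ≤ (P *ᵥ p.2) i}
  have hK : IsCompact K := by
    refine (isCompact_Icc.prod (isCompact_stdSimplex ℝ ι)).inter_right ?_
    simp only [Set.ofPred_forall]
    refine isClosed_iInter fun i => isClosed_le (by fun_prop) ?_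
    exact (continuous_apply i).comp (continuous_const.matrix_mulVec continuous_snd)
  have mem : ∀ s : ℝ, 0 ≤ s → ∀ y ∈ stdSimplex ℝ ι, (∀ i, s * y i ≤ (P *ᵥ y) i) → (s, y) ∈ K :=
    fun s hs y hy h => ⟨⟨⟨hs, bound s y hy h⟩, hy⟩, h⟩
  have hne : K.Nonempty := by
    obtain ⟨i₀⟩ := ‹Nonempty ι›
    refine ⟨_, mem 0 le_rfl _ (single_mem_stdSimplex ℝ i₀) fun i => ?_⟩
    rw [zero_mul]
    refine (mulVec_pos_of_pos hP (single_mem_stdSimplex ℝ i₀).1 (k := i₀) ?_ i).le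
    simp
  obtain ⟨⟨r, x⟩, hmem, hmax⟩ := hK.exists_isMaxOn hne continuous_fst.continuousOn
  refine ⟨r, x, hmem.1.2, hmem.2, fun s y hy h => ?_⟩
  rcases le_total 0 s with hs | hs
  · exact hmax (mem s hs y hy h)
  · exact hs.trans hmem.1.1.1

theorem exists_pos_eigenvector [Nonempty ι] {P : Matrix ι ι ℝ} (hP : ∀ i j, 0 < P i j) :
    ∃ r : ℝ, ∃ x ∈ stdSimplex ℝ ι, (∀ i, 0 < x i) ∧ P *ᵥ x = r • x := by
  obtain ⟨r, x, hx, hle, hmax⟩ := exists_max_mul_le_mulVec hP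
  have hxk : ∃ k, x k ≠ 0 := by
    by_contra! h
    simpa [h] using hx.2
  obtain ⟨k, hk⟩ := hxk
  have hy : ∀ i, 0 < (P *ᵥ x) i := mulVec_pos_of_pos hP hx.1 hk
  have heig : P *ᵥ x = r • x := by
    by_contra hne
    obtain ⟨m, hm⟩ := Function.ne_iff.1 hne
    have hz := mulVec_pos_of_pos hP (z := P *ᵥ x - r • x)
      (fun i => sub_nonneg.2 (hle i)) (k := m) (sub_ne_zero.2 hm)
    simp only [Matrix.mulVec_sub, Matrix.mulVec_smul, Pi.sub_apply, Pi.smul_apply,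
      smul_eq_mul] at hz
    obtain ⟨t, ht, i, hi⟩ := exists_mul_le_of_pos (z := P *ᵥ (P *ᵥ x)) hy
    have hrt : r < t := by
      have h1 := hz i
      rw [← hi, ← sub_mul] at h1
      exact sub_pos.1 (pos_of_mul_pos_left h1 (hy i).le)
    have hS : 0 < ∑ j, (P *ᵥ x) j := Finset.sum_pos (fun j _ => hy j) Finset.univ_nonempty
    refine hrt.not_ge (hmax t ((∑ j, (P *ᵥ x) j)⁻¹ • P *ᵥ x) ⟨fun j => ?_, ?_⟩ fun j => ?_)
    · exact mul_nonneg (inv_nonneg.2 hS.le) (hy j).le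
    · simp only [Pi.smul_apply, smul_eq_mul, ← Finset.mul_sum]
      exact inv_mul_cancel₀ hS.ne'
    · rw [Matrix.mulVec_smul]
      simp only [Pi.smul_apply, smul_eq_mul]
      rw [mul_left_comm]
      exact mul_le_mul_of_nonneg_left (ht j) (inv_nonneg.2 hS.le)
  refine ⟨r, x, hx, fun i => (hx.1 i).lt_of_ne' fun h => ?_, heig⟩
  have := hy i
  rw [heig] at this
  simp [h] at this

theorem exists_eigenvector_of_commute [Nonempty ι] {P M : Matrix ι ι ℝ}
    (hP : ∀ i j, 0 < P i j) (hPM : P * M = M * P) :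
    ∃ l : ℝ, ∃ x ∈ stdSimplex ℝ ι, M *ᵥ x = l • x := by
  obtain ⟨r, x, hx, hpos, heig⟩ := exists_pos_eigenvector hP
  obtain ⟨t, ht, i, hi⟩ := exists_mul_le_of_pos (z := M *ᵥ x) hpos
  refine ⟨t, x, hx, ?_⟩
  by_contra hne
  obtain ⟨m, hm⟩ := Function.ne_iff.1 hne
  have hz := mulVec_pos_of_pos hP (z := M *ᵥ x - t • x)
    (fun j => sub_nonneg.2 (ht j)) (k := m) (sub_ne_zero.2 hm) i
  have h1 : P *ᵥ (M *ᵥ x) = r • M *ᵥ x := by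
    rw [Matrix.mulVec_mulVec, hPM, ← Matrix.mulVec_mulVec, heig, Matrix.mulVec_smul]
  rw [Matrix.mulVec_sub, Matrix.mulVec_smul, h1, heig] at hz
  simp only [Pi.sub_apply, Pi.smul_apply, smul_eq_mul, ← hi] at hz
  exact hz.ne' (by ring)

end PositiveMatrix

theorem AlgPositive.exists_eigenvector {n : ℕ} [NeZero n] {M : Matrix (Fin n) (Fin n) ℝ}
    (hM : AlgPositive M) : ∃ l : ℝ, ∃ x ∈ stdSimplex ℝ (Fin n), M *ᵥ x = l • x := by
  obtain ⟨f, hf⟩ := hM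
  refine exists_eigenvector_of_commute hf ?_
  simpa using ((Commute.all f Polynomial.X).map (Polynomial.aeval M)).eq

theorem AlgPositive.neg {n : ℕ} {M : Matrix (Fin n) (Fin n) ℝ} (hM : AlgPositive (-M)) :
    AlgPositive M := by
  obtain ⟨f, hf⟩ := hM
  refine ⟨f.comp (-Polynomial.X), ?_⟩
  simpa [Polynomial.aeval_comp] using hf

theorem AlgPositive.transpose {n : ℕ} {M : Matrix (Fin n) (Fin n) ℝ} (hM : AlgPositive Mᵀ) :
    AlgPositive M := by
  obtain ⟨f, hf⟩ := hM
  refine ⟨f, fun i j => ?_⟩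
  have h := Polynomial.aeval_algHom_apply
    (Matrix.transposeAlgEquiv (Fin n) ℝ ℝ) M f
  have h2 : Polynomial.aeval Mᵀ f = (Polynomial.aeval M f)ᵀ := by
    have h3 := congrArg MulOpposite.unop h
    simpa [Matrix.transposeAlgEquiv, Polynomial.aeval_op_apply] using h3
  simpa [h2] using hf j i

theorem RequiresAP.neg {n : ℕ} {A : Matrix (Fin n) (Fin n) SignType} (hA : RequiresAP A) :
    RequiresAP (-A) := fun B hB =>
  AlgPositive.neg (hA (-B) fun i j => by simp [Left.sign_neg, hB i j])

theorem RequiresAP.transpose {n : ℕ} {A : Matrix (Fin n) (Fin n) SignType} (hA : RequiresAP A) :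
    RequiresAP Aᵀ := fun B hB =>
  AlgPositive.transpose (hA Bᵀ fun i j => hB j i)

section Cycle

variable {n : ℕ} [NeZero n]

theorem add_one_ne_self (hn : 3 ≤ n) (i : Fin n) : i + 1 ≠ i := by
  intro h
  have h1 : ((1 : Fin n) : ℕ) = ((0 : Fin n) : ℕ) := by
    rw [left_eq_add.1 h.symm]
  rw [Fin.val_one', Nat.mod_eq_of_lt (by lia)] at h1
  simp at h1

theorem add_one_add_one_ne_self (hn : 3 ≤ n) (i : Fin n) : i + 1 + 1 ≠ i := by
  intro h
  have h1 : ((1 + 1 : Fin n) : ℕ) = ((0 : Fin n) : ℕ) := by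
    rw [left_eq_add.1 (h.symm.trans (add_assoc i 1 1))]
  rw [Fin.val_add, Fin.val_one', Nat.mod_eq_of_lt (by lia : 1 < n),
    Nat.mod_eq_of_lt (by lia : 1 + 1 < n)] at h1
  simp at h1

/-- The matrix with weights `a i` on the arcs `(i, i + 1)`, `-a i` on the arcs `(i + 1, i)`,
and diagonal `d`. -/
def skewCycleMatrix (a d : Fin n → ℝ) : Matrix (Fin n) (Fin n) ℝ := fun i j =>
  (if j = i + 1 then a i else 0) - (if j = i - 1 then a j else 0) + (if j = i then d i else 0)

theorem skewCycleMatrix_mulVec (a d x : Fin n → ℝ) (i : Fin n) :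
    (skewCycleMatrix a d *ᵥ x) i = a i * x (i + 1) - a (i - 1) * x (i - 1) + d i * x i := by
  simp [skewCycleMatrix, Matrix.mulVec, dotProduct, add_mul, sub_mul, Finset.sum_add_distrib,
    Finset.sum_sub_distrib]

theorem inQClass_skewCycleMatrix (hn : 3 ≤ n) {A : Matrix (Fin n) (Fin n) SignType}
    (hcyc : CycleForm A) (hp : ∀ i, A i (i + 1) = 1) (hm : ∀ i, A (i + 1) i = -1)
    {a d : Fin n → ℝ} (ha : ∀ i, 0 < a i) (hd : ∀ i, SignType.sign (d i) = A i i) :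
    InQClass A (skewCycleMatrix a d) := by
  intro i j
  have h1 := add_one_ne_self hn
  have h2 := add_one_add_one_ne_self hn
  by_cases hij : j = i
  · subst hij
    have h3 : j ≠ j - 1 := fun h => h1 j (eq_sub_iff_add_eq.1 h)
    simp [skewCycleMatrix, (h1 j).symm, h3, hd]
  by_cases hj : j = i + 1
  · subst hj
    have h3 : i + 1 ≠ i - 1 := fun h => h2 i (eq_sub_iff_add_eq.1 h)
    simp [skewCycleMatrix, h1, h3, hp, ha]
  by_cases hi : i = j + 1
  · subst hi
    simp [skewCycleMatrix, hij, hj, hm, ha]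
  have h3 : j ≠ i - 1 := fun h => hi (eq_sub_iff_add_eq.1 h).symm
  simp [skewCycleMatrix, hij, hj, h3, hcyc.1 i j (Ne.symm hij) hj hi]

/-- Requiring algebraic positivity passes to an eigenvector statement on the closure of the
qualitative class. -/
theorem RequiresAP.exists_eigenvector_closure (hn : 3 ≤ n)
    {A : Matrix (Fin n) (Fin n) SignType} (hA : RequiresAP A)
    (hcyc : CycleForm A) (hp : ∀ i, A i (i + 1) = 1) (hm : ∀ i, A (i + 1) i = -1)
    {w e : Fin n → ℝ} (hw : ∀ i, 0 ≤ w i) (he : ∀ i, 0 ≤ e i) :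
    ∃ l : ℝ, ∃ x ∈ stdSimplex ℝ (Fin n), ∀ i,
      w i * x (i + 1) - w (i - 1) * x (i - 1) + e i * (A i i : ℝ) * x i = l * x i := by
  let F : ℝ × (Fin n → ℝ) → Fin n → ℝ := fun p i =>
    (w i + p.1) * p.2 (i + 1) - (w (i - 1) + p.1) * p.2 (i - 1) +
      (e i + p.1) * (A i i : ℝ) * p.2 i
  have hF : Continuous F := by fun_prop
  let G : ℝ × (Fin n → ℝ) → Fin n → ℝ := fun p i => F p i - (∑ j, F p j) * p.2 i
  have hG : Continuous G := by fun_prop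
  have key : ∀ t : ℝ, 0 < t → ∃ x ∈ stdSimplex ℝ (Fin n), G (t, x) = 0 := by
    intro t ht
    have hQ := inQClass_skewCycleMatrix hn hcyc hp hm
      (a := fun i => w i + t) (d := fun i => (e i + t) * (A i i : ℝ))
      (fun i => add_pos_of_nonneg_of_pos (hw i) ht) fun i => by
        have : 0 < e i + t := add_pos_of_nonneg_of_pos (he i) ht
        rw [sign_mul, sign_pos this, one_mul]
        cases A i i <;> simp
    obtain ⟨l, x, hx, heig⟩ := (hA _ hQ).exists_eigenvector
    have hFx : ∀ i, F (t, x) i = l * x i := fun i => by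
      rw [← smul_eq_mul, ← Pi.smul_apply, ← heig, skewCycleMatrix_mulVec]
    refine ⟨x, hx, funext fun i => ?_⟩
    simp only [G, hFx, ← Finset.mul_sum, hx.2]
    simp
  choose! u hu hGu using key
  obtain ⟨x, hx, φ, hφ, hlim⟩ := (isCompact_stdSimplex ℝ (Fin n)).tendsto_subseq
    (x := fun k : ℕ => u (1 / (k + 1))) fun k => hu _ (by positivity)
  have ht : Filter.Tendsto (fun k : ℕ => (1 / ((φ k : ℝ) + 1))) Filter.atTop (nhds 0) :=
    tendsto_one_div_add_atTop_nhds_zero_nat.comp hφ.tendsto_atTop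
  have hlimG := (hG.tendsto (0, x)).comp (ht.prodMk_nhds hlim)
  have hzero : G (0, x) = 0 := by
    refine tendsto_nhds_unique hlimG ?_
    refine tendsto_const_nhds.congr fun k => ?_
    exact (hGu _ (by positivity)).symm
  refine ⟨∑ j, F (0, x) j, x, hx, fun i => ?_⟩
  simpa [G, F, sub_eq_zero] using congrFun hzero i

theorem eq_zero_of_rotation {l a b : ℝ} (h1 : b = l * a) (h2 : -a = l * b) :
    a = 0 ∧ b = 0 := by
  have ha : (1 + l ^ 2) * a = 0 := by linear_combination -h2 - l * h1
  have ha' : a = 0 := (mul_eq_zero.1 ha).resolve_left (by positivity)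
  exact ⟨ha', by rw [h1, ha', mul_zero]⟩

theorem eq_zero_of_rotation_three {l a b c : ℝ} (ha : 0 ≤ a) (hb : 0 ≤ b) (hc : 0 ≤ c)
    (h1 : b + a = l * a) (h2 : c - a = l * b) (h3 : -b = l * c) :
    a = 0 ∧ b = 0 ∧ c = 0 := by
  have hb0 : b = 0 := by
    rcases le_total l 0 with hl | hl
    · nlinarith [mul_nonneg (neg_nonneg.2 hl) ha]
    · nlinarith [mul_nonneg hl hc]
  subst hb0
  have hca : c = a := by linarith
  subst hca
  have : c = 0 := by linarith
  simp [this]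

theorem natCast_add_one_eq (i₀ : Fin n) (k : ℕ) :
    i₀ + (Fin.ofNat n (k + 1)) = i₀ + Fin.ofNat n k + 1 := by
  rw [add_assoc]
  congr 1
  ext
  simp [Fin.val_add]

theorem exists_eq_add_ofNat (i₀ i : Fin n) : ∃ k < n, i = i₀ + Fin.ofNat n k :=
  ⟨(i - i₀ : Fin n), (i - i₀).isLt, by simp⟩

/-- The relations along the cycle started at `i₀`, with arc weights `w k` for the arc between the
`k`-th and `(k + 1)`-st vertex and a weight `c` on the diagonal entry of `i₀`. -/
theorem RequiresAP.exists_sequence (hn : 3 ≤ n)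
    {A : Matrix (Fin n) (Fin n) SignType} (hA : RequiresAP A)
    (hcyc : CycleForm A) (hp : ∀ i, A i (i + 1) = 1) (hm : ∀ i, A (i + 1) i = -1)
    (i₀ : Fin n) {w : ℕ → ℝ} {c : ℝ} (hw : ∀ k, 0 ≤ w k) (hc : 0 ≤ c) (hlast : w (n - 1) = 0) :
    ∃ l : ℝ, ∃ X : ℕ → ℝ, (∀ k, 0 ≤ X k) ∧ (∃ k < n, X k ≠ 0) ∧
      w 0 * X 1 + c * (A i₀ i₀ : ℝ) * X 0 = l * X 0 ∧
      ∀ k, k + 1 < n → w (k + 1) * X (k + 2) - w k * X k = l * X (k + 1) := by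
  obtain ⟨l, x, hx, h⟩ := hA.exists_eigenvector_closure hn hcyc hp hm
    (w := fun i => w (i - i₀ : Fin n)) (e := Pi.single i₀ c) (fun i => hw _)
    (fun i => by
      rcases eq_or_ne i i₀ with rfl | hi
      · simpa
      · simp [hi])
  have hval : ∀ k < n, ((i₀ + Fin.ofNat n k - i₀ : Fin n) : ℕ) = k := fun k hk => by
    simp [Nat.mod_eq_of_lt hk]
  refine ⟨l, fun k => x (i₀ + Fin.ofNat n k), fun k => hx.1 _, ?_, ?_, fun k hk => ?_⟩
  · by_contra! hzero
    have : ∀ i, x i = 0 := fun i => by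
      obtain ⟨k, hk, rfl⟩ := exists_eq_add_ofNat i₀ i
      exact hzero k hk
    simpa [this] using hx.2
  · have hpred : ((i₀ - 1 - i₀ : Fin n) : ℕ) = n - 1 := by
      have : i₀ - 1 - i₀ = -1 := by abel
      rw [this, Fin.val_neg', Fin.val_one', Nat.mod_eq_of_lt (by lia : 1 < n),
        Nat.mod_eq_of_lt (by lia)]
    have h0 : i₀ + Fin.ofNat n 0 = i₀ := by simp
    have h1 := natCast_add_one_eq i₀ 0
    have := h i₀
    simp only [hpred, hlast] at this
    rw [zero_add] at h1
    beta_reduce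
    rw [h1, h0]
    simpa using this
  · have hne : i₀ + Fin.ofNat n (k + 1) ≠ i₀ := fun h => by
      have := hval (k + 1) hk
      simp only [h, sub_self, Fin.val_zero] at this
      lia
    have h1 := natCast_add_one_eq i₀ k
    have h2 := natCast_add_one_eq i₀ (k + 1)
    have h3 : i₀ + Fin.ofNat n (k + 1) - 1 = i₀ + Fin.ofNat n k := by rw [h1, add_sub_cancel_right]
    have := h (i₀ + Fin.ofNat n (k + 1))
    rw [← h2, h3] at this
    simpa only [hval k (by lia), hval (k + 1) hk, Pi.single_eq_of_ne hne, zero_mul, add_zero]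
      using this

theorem RequiresAP.odd_of_skewCycle (hn : 3 ≤ n)
    {A : Matrix (Fin n) (Fin n) SignType} (hA : RequiresAP A)
    (hcyc : CycleForm A) (hp : ∀ i, A i (i + 1) = 1) (hm : ∀ i, A (i + 1) i = -1) : Odd n := by
  by_contra hodd
  rw [Nat.not_odd_iff_even] at hodd
  obtain ⟨l, X, -, ⟨k, hk, hXk⟩, h0, h⟩ := hA.exists_sequence hn hcyc hp hm 0
    (w := fun k => if Even k then 1 else 0) (c := 0) (fun k => by split_ifs <;> simp) le_rfl
    (if_neg (by grind))
  have pair : ∀ m, Even m → m + 1 < n → X m = 0 ∧ X (m + 1) = 0 := by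
    intro m hm hmn
    refine eq_zero_of_rotation (l := l) ?_ ?_
    · rcases m with _ | m
      · simpa using h0
      · have := h m (by lia)
        simpa [hm, show ¬ Even m by grind] using this
    · have := h m hmn
      simpa [hm, show ¬ Even (m + 1) by grind] using this
  rcases Nat.even_or_odd k with hke | hko
  · exact hXk (pair k hke (by grind)).1
  · obtain ⟨m, rfl⟩ : ∃ m, k = m + 1 := ⟨k - 1, by grind⟩
    exact hXk (pair m (by grind) hk).2

theorem RequiresAP.diag_ne_one_of_skewCycle (hn : 3 ≤ n)
    {A : Matrix (Fin n) (Fin n) SignType} (hA : RequiresAP A)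
    (hcyc : CycleForm A) (hp : ∀ i, A i (i + 1) = 1) (hm : ∀ i, A (i + 1) i = -1)
    (i₀ : Fin n) : A i₀ i₀ ≠ 1 := by
  intro hdiag
  have hodd := hA.odd_of_skewCycle hn hcyc hp hm
  obtain ⟨l, X, hX, ⟨k, hk, hXk⟩, h0, h⟩ := hA.exists_sequence hn hcyc hp hm i₀
    (w := fun k => if k = 0 ∨ Odd k then 1 else 0) (c := 1) (fun k => by split_ifs <;> simp)
    zero_le_one (if_neg (by grind))
  have first : X 0 = 0 ∧ X 1 = 0 ∧ X 2 = 0 := by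
    have h1 := h 0 (by lia)
    have h2 := h 1 (by lia)
    simp only [hdiag] at h0
    refine eq_zero_of_rotation_three (l := l) (hX 0) (hX 1) (hX 2) ?_ ?_ ?_
    · simpa using h0
    · simpa using h1
    · simpa [show ¬ Odd 2 by decide] using h2
  have pair : ∀ m, Even m → m + 3 < n → X (m + 3) = 0 ∧ X (m + 4) = 0 := by
    intro m hm hmn
    refine eq_zero_of_rotation (l := l) ?_ ?_
    · have := h (m + 2) (by lia)
      simpa [show Odd (m + 3) by grind, show ¬ Odd (m + 2) by grind] using this
    · have := h (m + 3) (by grind)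
      simpa [show Odd (m + 3) by grind, show ¬ Odd (m + 4) by grind] using this
  match k with
  | 0 => exact hXk first.1
  | 1 => exact hXk first.2.1
  | 2 => exact hXk first.2.2
  | k + 3 =>
    rcases Nat.even_or_odd k with hke | hko
    · exact hXk (pair k hke hk).1
    · obtain ⟨m, rfl⟩ : ∃ m, k = m + 1 := ⟨k - 1, by grind⟩
      exact hXk (pair m (by grind) (by lia)).2

theorem CycleForm.transpose {A : Matrix (Fin n) (Fin n) SignType} (hcyc : CycleForm A) :
    CycleForm Aᵀ :=
  ⟨fun i j hij h1 h2 => hcyc.1 j i hij.symm h2 h1, fun i => (hcyc.2 i).symm⟩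

theorem CycleForm.neg {A : Matrix (Fin n) (Fin n) SignType} (hcyc : CycleForm A) :
    CycleForm (-A) := by
  have hz : ∀ s : SignType, -s = 0 ↔ s = 0 := by decide
  exact ⟨fun i j hij h1 h2 => (hz _).2 (hcyc.1 i j hij h1 h2),
    fun i => (hcyc.2 i).imp (mt (hz _).1) (mt (hz _).1)⟩

theorem RequiresAP.odd_and_diag_eq_zero_of_skewCycle (hn : 3 ≤ n)
    {A : Matrix (Fin n) (Fin n) SignType} (hA : RequiresAP A)
    (hcyc : CycleForm A) (hp : ∀ i, A i (i + 1) = 1) (hm : ∀ i, A (i + 1) i = -1) :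
    Odd n ∧ ∀ i, A i i = 0 := by
  refine ⟨hA.odd_of_skewCycle hn hcyc hp hm, fun i => ?_⟩
  have h1 := hA.diag_ne_one_of_skewCycle hn hcyc hp hm i
  have h2 := hA.transpose.neg.diag_ne_one_of_skewCycle hn hcyc.transpose.neg
    (fun j => by simp [hm]) (fun j => by simp [hp]) i
  simp only [Matrix.neg_apply, Matrix.transpose_apply] at h2
  generalize A i i = s at h1 h2
  revert h1 h2
  revert s
  decide

end Cycle

/-- Cycle-form `A` with all directed 2-cycles negative, a directed
`n`-cycle in `D(A_+)`, some negative 2-cycle, and requiring algebraic positivity: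
if `D(A_-)` also contains a directed `n`-cycle, then `n` is odd and the diagonal is zero. -/
theorem stmt_13 {n : ℕ} [NeZero n] (hn : 3 ≤ n) (A : Matrix (Fin n) (Fin n) SignType)
    (hcyc : CycleForm A)
    (hneg2 : ∀ i j : Fin n, i ≠ j → A i j ≠ 0 → A j i ≠ 0 → A i j * A j i = -1)
    (hplus : PlusNCycle A)
    (hex : ∃ i j : Fin n, i ≠ j ∧ A i j * A j i = -1)
    (hreq : RequiresAP A)
    (hminus : MinusNCycle A) :
    Odd n ∧ ∀ i : Fin n, A i i = 0 := by
  have hne : (1 : SignType) ≠ -1 := by decide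
  rcases hplus with hp | hp <;> rcases hminus with hm | hm
  · exact absurd ((hp 0).symm.trans (hm 0)) hne
  · exact hreq.odd_and_diag_eq_zero_of_skewCycle hn hcyc hp hm
  · exact hreq.transpose.odd_and_diag_eq_zero_of_skewCycle hn hcyc.transpose hp hm
  · exact absurd ((hp 0).symm.trans (hm 0)) hne
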